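/- Let 0 < a ≤ 1 and let s ∈ ℂ with 0 < Re(s) < 1. Then Γ(s) ζ(s,a) = ∫_0^∞ H(a,x) x^{s-1} dx, where the integral converges absolutely. -/

import Mathlib

open Set HurwitzZeta

/-- `H(a,x) = e^((1-a)x)/(e^x - 1) - 1/x`. -/
noncomputable def Hfun (a x : ℝ) : ℝ :=
  Real.exp ((1 - a) * x) / (Real.exp x - 1) - 1 / x

/-- `e^((1-a)x)/(e^x - 1)`, the Mellin density of `Γ(s) ζ(s,a)`, as a complex-valued function. -/
noncomputable def hurwitzKernel (a x : ℝ) : ℂ :=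
  ((Real.exp ((1 - a) * x) / (Real.exp x - 1) : ℝ) : ℂ)

/-- `hurwitzKernel` with its pole at the origin removed by a term supported on `(0, 1]`. -/
noncomputable def regularizedKernel (a x : ℝ) : ℂ :=
  hurwitzKernel a x - indicator (Ioc (0 : ℝ) 1) (fun t : ℝ => (t : ℂ) ^ (-1 : ℂ)) x

theorem abs_Hfun_le {a x : ℝ} (ha : 0 < a) (ha' : a ≤ 1) (hx : 0 < x) (hx1 : x ≤ 1) :
    |Hfun a x| ≤ 3 := by
  have he : x ≤ Real.exp x - 1 := by linarith [Real.add_one_le_exp x]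
  have hepos : 0 < Real.exp x - 1 := hx.trans_le he
  have h0 : 0 ≤ (1 - a) * x := mul_nonneg (by linarith) hx.le
  have hle : (1 - a) * x ≤ x := by nlinarith
  have h1 := Real.abs_exp_sub_one_sub_id_le (x := x) (by rw [abs_of_pos hx]; exact hx1)
  have h2 := Real.abs_exp_sub_one_sub_id_le (x := (1 - a) * x)
    (by rw [abs_of_nonneg h0]; linarith)
  have h3 : ((1 - a) * x) ^ 2 ≤ x ^ 2 := by gcongr
  rw [abs_le] at h1 h2
  have hH : Hfun a x =
      (x * Real.exp ((1 - a) * x) - (Real.exp x - 1)) / ((Real.exp x - 1) * x) := by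
    unfold Hfun
    field_simp
  have hden : x ^ 2 ≤ (Real.exp x - 1) * x := by nlinarith
  have hxx : x * x ^ 2 ≤ x ^ 2 := by nlinarith [sq_nonneg x]
  have hu : x * Real.exp ((1 - a) * x) ≤ x * (1 + (1 - a) * x + x ^ 2) := by
    gcongr; linarith
  have hl : x * (1 + (1 - a) * x - x ^ 2) ≤ x * Real.exp ((1 - a) * x) := by
    gcongr; linarith
  have hm : x * ((1 - a) * x) ≤ x ^ 2 := by nlinarith
  have hm0 : 0 ≤ x * ((1 - a) * x) := by positivity
  rw [hH, abs_div, abs_of_pos (mul_pos hepos hx), div_le_iff₀ (mul_pos hepos hx), abs_le]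
  constructor <;> nlinarith

theorem hurwitzKernel_sub_inv (a x : ℝ) :
    hurwitzKernel a x - (x : ℂ) ^ (-1 : ℂ) = (Hfun a x : ℂ) := by
  simp [hurwitzKernel, Hfun, Complex.cpow_neg_one]

theorem continuousOn_hurwitzKernel (a : ℝ) : ContinuousOn (hurwitzKernel a) (Ioi 0) := by
  refine Complex.continuous_ofReal.comp_continuousOn (ContinuousOn.div (by fun_prop) (by fun_prop) ?_)
  intro x hx
  have := Real.one_lt_exp_iff.mpr (mem_Ioi.mp hx)
  linarith

open MeasureTheory in
theorem locallyIntegrableOn_regularizedKernel (a : ℝ) :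
    LocallyIntegrableOn (regularizedKernel a) (Ioi 0) := by
  refine ((continuousOn_hurwitzKernel a).locallyIntegrableOn measurableSet_Ioi).sub ?_
  have hc : ContinuousOn (fun t : ℝ => (t : ℂ) ^ (-1 : ℂ)) (Ioi 0) := fun t ht =>
    (Complex.continuousAt_ofReal_cpow_const _ _ (Or.inr (mem_Ioi.mp ht).ne')).continuousWithinAt
  intro x hx
  obtain ⟨t, ht, h⟩ := hc.locallyIntegrableOn (μ := volume) measurableSet_Ioi x hx
  exact ⟨t, ht, h.indicator measurableSet_Ioc⟩

open Filter Asymptotics Topology in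
theorem regularizedKernel_isBigO_zero {a : ℝ} (ha : 0 < a) (ha' : a ≤ 1) :
    regularizedKernel a =O[𝓝[>] 0] (fun x : ℝ => x ^ (-(0 : ℝ))) := by
  refine IsBigO.of_bound 3 ?_
  filter_upwards [Ioc_mem_nhdsGT (zero_lt_one (α := ℝ))] with x hx
  rw [regularizedKernel, indicator_of_mem hx, hurwitzKernel_sub_inv]
  simpa using abs_Hfun_le ha ha' hx.1 hx.2

open Filter Asymptotics in
theorem regularizedKernel_isBigO_atTop (a : ℝ) :
    regularizedKernel a =O[atTop] (fun x : ℝ => Real.exp (-a * x)) := by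
  refine IsBigO.of_bound 2 ?_
  filter_upwards [eventually_gt_atTop 1] with x hx
  have he : 2 ≤ Real.exp x := by linarith [Real.add_one_le_exp x]
  have hsplit : Real.exp ((1 - a) * x) = Real.exp (-a * x) * Real.exp x := by
    rw [← Real.exp_add]; ring_nf
  rw [regularizedKernel, indicator_of_notMem (fun h => hx.not_ge h.2), sub_zero, hurwitzKernel,
    Complex.norm_real, Real.norm_eq_abs, Real.norm_eq_abs, Real.abs_exp,
    abs_of_pos (div_pos (Real.exp_pos _) (by linarith)), div_le_iff₀ (by linarith), hsplit]
  nlinarith [Real.exp_pos (-a * x)]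

theorem mellinConvergent_regularizedKernel {a : ℝ} (ha : 0 < a) (ha' : a ≤ 1) {s : ℂ}
    (hs : 0 < s.re) : MellinConvergent (regularizedKernel a) s :=
  mellinConvergent_of_isBigO_rpow_exp ha (locallyIntegrableOn_regularizedKernel a)
    (regularizedKernel_isBigO_atTop a) (regularizedKernel_isBigO_zero ha ha') hs

theorem differentiableAt_mellin_regularizedKernel {a : ℝ} (ha : 0 < a) (ha' : a ≤ 1) {s : ℂ}
    (hs : 0 < s.re) : DifferentiableAt ℂ (mellin (regularizedKernel a)) s :=
  mellin_differentiableAt_of_isBigO_rpow_exp ha (locallyIntegrableOn_regularizedKernel a)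
    (regularizedKernel_isBigO_atTop a) (regularizedKernel_isBigO_zero ha ha') hs

theorem hasSum_hurwitzKernel (a : ℝ) {x : ℝ} (hx : 0 < x) :
    HasSum (fun n : ℕ => (1 : ℂ) * Real.exp (-((n : ℝ) + a) * x)) (hurwitzKernel a x) := by
  have hlt : Real.exp (-x) < 1 := Real.exp_lt_one_iff.mpr (by linarith)
  have h := (hasSum_geometric_of_lt_one (Real.exp_pos (-x)).le hlt).mul_left (Real.exp (-a * x))
  have hval : Real.exp (-a * x) * (1 - Real.exp (-x))⁻¹ =
      Real.exp ((1 - a) * x) / (Real.exp x - 1) := by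
    have h1 : Real.exp x - 1 ≠ 0 := by linarith [Real.one_lt_exp_iff.mpr hx]
    have h2 : 1 - Real.exp (-x) ≠ 0 := by linarith
    have h3 : Real.exp ((1 - a) * x) = Real.exp (-a * x) * Real.exp x := by
      rw [← Real.exp_add]; ring_nf
    have h4 : Real.exp x * Real.exp (-x) = 1 := by rw [← Real.exp_add]; simp
    rw [← div_eq_mul_inv, div_eq_div_iff h2 h1, h3]
    linear_combination (Real.exp (-a * x)) * h4
  rw [hval] at h
  refine (Complex.hasSum_ofReal.mpr h).congr_fun ?_
  intro n
  rw [one_mul, ← Real.exp_nat_mul, ← Real.exp_add]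
  ring_nf

theorem mellin_hurwitzKernel {a : ℝ} (ha : 0 < a) (ha' : a ≤ 1) {s : ℂ} (hs : 1 < s.re) :
    mellin (hurwitzKernel a) s = Complex.Gamma s * hurwitzZeta (a : UnitAddCircle) s := by
  have hpos (n : ℕ) : 0 < (n : ℝ) + a := by positivity
  have h := hasSum_mellin (a := fun _ : ℕ => (1 : ℂ)) (p := fun n : ℕ => (n : ℝ) + a)
    (F := hurwitzKernel a) (s := s) (fun n => Or.inr (hpos n)) (by linarith)
    (fun t ht => hasSum_hurwitzKernel a ht) (by
      refine ((Real.summable_one_div_nat_add_rpow a s.re).mpr hs).congr fun n => ?_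
      rw [abs_of_pos (hpos n), norm_one])
  refine h.unique ?_
  refine ((hasSum_hurwitzZeta_of_one_lt_re ⟨ha.le, ha'⟩ hs).mul_left (Complex.Gamma s)).congr_fun ?_
  intro n
  push_cast
  ring

theorem mellin_regularizedKernel_of_one_lt_re {a : ℝ} (ha : 0 < a) (ha' : a ≤ 1) {s : ℂ}
    (hs : 1 < s.re) : mellin (regularizedKernel a) s =
      Complex.Gamma s * hurwitzZeta (a : UnitAddCircle) s - 1 / (s - 1) := by
  have hP := hasMellin_cpow_Ioc (-1) (s := s) (by simpa using hs)
  have h := (hasMellin_add (mellinConvergent_regularizedKernel ha ha' (by linarith)) hP.1).2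
  have hF : (fun t : ℝ => regularizedKernel a t +
      indicator (Ioc (0 : ℝ) 1) (fun t : ℝ => (t : ℂ) ^ (-1 : ℂ)) t) = hurwitzKernel a :=
    funext fun t => sub_add_cancel _ _
  rw [hF, hP.2, mellin_hurwitzKernel ha ha' hs] at h
  rw [h]
  ring

theorem differentiableOn_update_sub_one_mul_Gamma_mul_hurwitzZeta (a : UnitAddCircle) :
    DifferentiableOn ℂ
      (Function.update (fun z => (z - 1) * hurwitzZeta a z * Complex.Gamma z) 1 1)
      {z | 0 < z.re} := by
  have hU : {z : ℂ | 0 < z.re} ∈ nhds (1 : ℂ) :=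
    (isOpen_lt continuous_const Complex.continuous_re).mem_nhds (by simp)
  have hG {z : ℂ} (hz : 0 < z.re) : DifferentiableAt ℂ Complex.Gamma z := by
    refine Complex.differentiableAt_Gamma _ fun m hm => ?_
    have : (0 : ℝ) ≤ m := m.cast_nonneg
    simp [hm] at hz
    linarith
  rw [← Complex.differentiableOn_compl_singleton_and_continuousAt_iff hU]
  constructor
  · refine DifferentiableOn.congr
      (f := fun z => (z - 1) * hurwitzZeta a z * Complex.Gamma z) ?_ ?_
    · intro z hz
      exact (((differentiableAt_id.sub_const 1).mul
        (differentiableAt_hurwitzZeta a hz.2)).mul (hG hz.1)).differentiableWithinAt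
    · intro z hz
      exact Function.update_of_ne hz.2 _ _
  · rw [continuousAt_update_same]
    simpa using (hurwitzZeta_residue_one a).mul
      ((hG (z := 1) (by simp)).continuousAt.tendsto.mono_left nhdsWithin_le_nhds)

theorem mellin_regularizedKernel {a : ℝ} (ha : 0 < a) (ha' : a ≤ 1) {s : ℂ}
    (hs : 0 < s.re) (hs1 : s ≠ 1) : mellin (regularizedKernel a) s =
      Complex.Gamma s * hurwitzZeta (a : UnitAddCircle) s - 1 / (s - 1) := by
  have hopen : IsOpen {z : ℂ | 0 < z.re} := isOpen_lt continuous_const Complex.continuous_re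
  have hL : DifferentiableOn ℂ (fun z => (z - 1) * mellin (regularizedKernel a) z + 1)
      {z | 0 < z.re} := fun z hz =>
    (((differentiableAt_id.sub_const 1).mul
      (differentiableAt_mellin_regularizedKernel ha ha' hz)).add_const 1).differentiableWithinAt
  have key := (hL.analyticOnNhd hopen).eqOn_of_preconnected_of_eventuallyEq
    ((differentiableOn_update_sub_one_mul_Gamma_mul_hurwitzZeta a).analyticOnNhd hopen)
    (convex_halfSpace_re_gt 0).isPreconnected (z₀ := 2) (by simp) (by
      filter_upwards [(isOpen_lt continuous_const Complex.continuous_re).mem_nhds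
        (show (1 : ℝ) < (2 : ℂ).re by simp)] with z hz
      have hz1 : z ≠ 1 := by
        rintro rfl
        simp at hz
      rw [Function.update_of_ne hz1, mellin_regularizedKernel_of_one_lt_re ha ha' hz]
      field_simp [sub_ne_zero.mpr hz1]
      ring) hs
  have hne := sub_ne_zero.mpr hs1
  simp only [Function.update_of_ne hs1] at key
  apply mul_left_cancel₀ hne
  rw [mul_sub, mul_one_div_cancel hne]
  linear_combination key

open MeasureTheory in
theorem hasMellin_cpow_Ioi_one (b : ℂ) {s : ℂ} (hs : s.re + b.re < 0) :
    HasMellin (indicator (Ioi 1) (fun t : ℝ => (t : ℂ) ^ b)) s (-1 / (s + b)) := by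
  have hre : (s - 1 + b).re < -1 := by simp; linarith
  have hfun : (fun t : ℝ => (t : ℂ) ^ (s - 1) •
      indicator (Ioi (1 : ℝ)) (fun t : ℝ => (t : ℂ) ^ b) t) =
      indicator (Ioi (1 : ℝ)) (fun t : ℝ => (t : ℂ) ^ (s - 1 + b)) := by
    ext t
    by_cases ht : t ∈ Ioi (1 : ℝ)
    · have : (t : ℂ) ≠ 0 := by exact_mod_cast (zero_lt_one.trans (mem_Ioi.mp ht)).ne'
      rw [indicator_of_mem ht, indicator_of_mem ht, Complex.cpow_add _ _ this, smul_eq_mul]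
    · rw [indicator_of_notMem ht, indicator_of_notMem ht, smul_zero]
  have hint := integrableOn_Ioi_cpow_of_lt hre zero_lt_one
  constructor
  · rw [MellinConvergent, hfun]
    exact (hint.integrable_indicator measurableSet_Ioi).integrableOn
  · rw [mellin, hfun, setIntegral_indicator measurableSet_Ioi,
      inter_eq_right.mpr (Ioi_subset_Ioi zero_le_one), integral_Ioi_cpow_of_lt hre zero_lt_one]
    simp only [Complex.ofReal_one, Complex.one_cpow]
    congr 1
    ring

theorem regularizedKernel_sub_indicator (a : ℝ) {x : ℝ} (hx : 0 < x) :
    regularizedKernel a x - indicator (Ioi (1 : ℝ)) (fun t : ℝ => (t : ℂ) ^ (-1 : ℂ)) x =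
      (Hfun a x : ℂ) := by
  rw [regularizedKernel, ← hurwitzKernel_sub_inv]
  by_cases h : x ≤ 1
  · rw [indicator_of_mem (show x ∈ Ioc 0 1 from ⟨hx, h⟩),
      indicator_of_notMem (show x ∉ Ioi 1 from not_lt.mpr h), sub_zero]
  · rw [indicator_of_notMem (fun h' => h h'.2),
      indicator_of_mem (show x ∈ Ioi 1 from not_le.mp h), sub_zero]

theorem gamma_mul_hurwitzZeta_eq_integral_H (a : ℝ) (ha : 0 < a) (ha' : a ≤ 1)
    (s : ℂ) (hs0 : 0 < s.re) (hs1 : s.re < 1) :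
    MeasureTheory.IntegrableOn
      (fun x : ℝ => (Hfun a x : ℂ) * (x : ℂ) ^ (s - 1)) (Ioi (0 : ℝ)) ∧
    Complex.Gamma s * hurwitzZeta (a : UnitAddCircle) s =
      ∫ x in Ioi (0 : ℝ), (Hfun a x : ℂ) * (x : ℂ) ^ (s - 1) := by
  have hQ := hasMellin_cpow_Ioi_one (-1) (s := s) (by simp; linarith)
  have hs : s ≠ 1 := by
    rintro rfl
    simp at hs1
  obtain ⟨hconv, hval⟩ := hasMellin_sub (mellinConvergent_regularizedKernel ha ha' hs0) hQ.1
  have hcongr : EqOn (fun x : ℝ => (x : ℂ) ^ (s - 1) • (regularizedKernel a x -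
      indicator (Ioi (1 : ℝ)) (fun t : ℝ => (t : ℂ) ^ (-1 : ℂ)) x))
      (fun x : ℝ => (Hfun a x : ℂ) * (x : ℂ) ^ (s - 1)) (Ioi 0) := fun x hx => by
    simp only [regularizedKernel_sub_indicator a (mem_Ioi.mp hx), smul_eq_mul]
    ring
  refine ⟨MeasureTheory.IntegrableOn.congr_fun hconv hcongr measurableSet_Ioi, ?_⟩
  rw [← MeasureTheory.setIntegral_congr_fun measurableSet_Ioi hcongr]
  rw [hQ.2, mellin_regularizedKernel ha ha' hs0 hs] at hval
  rw [mellin] at hval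
  rw [hval]
  ring
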